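/- There is an absolute constant c > 0 with the following property. Let q be an odd prime power, E ⊆ 𝔽_q², t ∈ 𝔽_q^*, and (u₀,v₀) ∈ E×E with ‖u₀−v₀‖ = t, and let X_t = { g ∈ G₀ : g⁻¹u₀ ∈ E and g⁻¹v₀ ∈ E }. Then |X_tX_t| ≥ c·min{ q²|X_t|/|E| , |X_t|²/q² }. -/

import Mathlib

open Matrix

/-- The special orthogonal group `SO₂` over a field `F`, i.e. the rotation matrices
`!![a, -b; b, a]` with `a² + b² = 1`, as a subgroup of the units of `2×2` matrices. -/
def SO2 (F : Type) [Field F] : Subgroup (Matrix (Fin 2) (Fin 2) F)ˣ where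
  carrier := {h | ∃ a b : F, a ^ 2 + b ^ 2 = 1 ∧
    (h : Matrix (Fin 2) (Fin 2) F) = !![a, -b; b, a]}
  one_mem' := ⟨1, 0, by ring, by simp [Matrix.one_fin_two]⟩
  mul_mem' := by
    rintro x y ⟨a, b, hab, hx⟩ ⟨c, d, hcd, hy⟩
    refine ⟨a * c - b * d, a * d + b * c, ?_, ?_⟩
    · have h : (a * c - b * d) ^ 2 + (a * d + b * c) ^ 2
        = (a ^ 2 + b ^ 2) * (c ^ 2 + d ^ 2) := by ring
      rw [h, hab, hcd, one_mul]
    · rw [Units.val_mul, hx, hy, Matrix.mul_fin_two]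
      congr 1 <;> ring
  inv_mem' := by
    rintro x ⟨a, b, hab, hx⟩
    refine ⟨a, -b, by rw [neg_sq]; exact hab, ?_⟩
    have hmul : (x : Matrix (Fin 2) (Fin 2) F) * !![a, - -b; -b, a] = 1 := by
      rw [hx]
      ext i j
      fin_cases i <;> fin_cases j <;>
        simp [Matrix.mul_apply, Fin.sum_univ_two, Matrix.one_apply] <;>
        (first
          | ring1
          | linear_combination hab
          | linear_combination -hab)
    calc (↑x⁻¹ : Matrix (Fin 2) (Fin 2) F)
        = ↑x⁻¹ * ((x : Matrix (Fin 2) (Fin 2) F) * !![a, - -b; -b, a]) := by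
          rw [hmul, mul_one]
      _ = (↑x⁻¹ * (x : Matrix (Fin 2) (Fin 2) F)) * !![a, - -b; -b, a] := by
          rw [mul_assoc]
      _ = !![a, - -b; -b, a] := by rw [Units.inv_mul, one_mul]

/-- The matrix of an element of `SO₂`. -/
def SO2.mat {F : Type} [Field F] (h : SO2 F) : Matrix (Fin 2) (Fin 2) F :=
  ((h : (Matrix (Fin 2) (Fin 2) F)ˣ) : Matrix (Fin 2) (Fin 2) F)

lemma SO2.mat_inv_mul {F : Type} [Field F] (h : SO2 F) : SO2.mat h⁻¹ * SO2.mat h = 1 := by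
  simp only [SO2.mat, InvMemClass.coe_inv, Units.inv_mul]

lemma SO2.mat_mul_inv {F : Type} [Field F] (h : SO2 F) : SO2.mat h * SO2.mat h⁻¹ = 1 := by
  simp only [SO2.mat, InvMemClass.coe_inv, Units.mul_inv]

lemma SO2.mat_mul {F : Type} [Field F] (h₁ h₂ : SO2 F) :
    SO2.mat (h₁ * h₂) = SO2.mat h₁ * SO2.mat h₂ := by
  simp only [SO2.mat, MulMemClass.coe_mul, Units.val_mul]

lemma SO2.mat_one {F : Type} [Field F] : SO2.mat (1 : SO2 F) = 1 := by
  simp only [SO2.mat, OneMemClass.coe_one, Units.val_one]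

/-- The action of `SO₂(F)` on `F²` by matrix-vector multiplication, as a homomorphism
into the automorphisms of the (multiplicative version of the) additive group `F²`. -/
def rotHom (F : Type) [Field F] : SO2 F →* MulAut (Multiplicative (Fin 2 → F)) where
  toFun h :=
    { toFun := fun v => Multiplicative.ofAdd ((SO2.mat h).mulVec v.toAdd)
      invFun := fun v => Multiplicative.ofAdd ((SO2.mat h⁻¹).mulVec v.toAdd)
      left_inv := fun v => by
        simp only [toAdd_ofAdd, Matrix.mulVec_mulVec, SO2.mat_inv_mul,
          Matrix.one_mulVec, ofAdd_toAdd]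
      right_inv := fun v => by
        simp only [toAdd_ofAdd, Matrix.mulVec_mulVec, SO2.mat_mul_inv,
          Matrix.one_mulVec, ofAdd_toAdd]
      map_mul' := fun u v => by
        simp only [toAdd_mul, Matrix.mulVec_add, ofAdd_add] }
  map_one' := by
    ext v
    simp [SO2.mat_one, Matrix.one_mulVec]
  map_mul' h₁ h₂ := by
    ext v
    simp only [MulEquiv.coe_mk, Equiv.coe_fn_mk, MulAut.mul_apply, toAdd_ofAdd,
      Matrix.mulVec_mulVec, SO2.mat_mul]

/-- The group `G₀ = F² ⋊ SO₂(F)` of rigid motions of the plane `F²`. -/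
abbrev G0 (F : Type) [Field F] : Type :=
  Multiplicative (Fin 2 → F) ⋊[rotHom F] SO2 F

instance {N H : Type*} [Group N] [Group H] {φ : H →* MulAut N} [Finite N] [Finite H] :
    Finite (N ⋊[φ] H) :=
  Finite.of_injective (fun g => (g.left, g.right))
    (by rintro ⟨a, b⟩ ⟨c, d⟩ h
        simp only [Prod.mk.injEq] at h
        simp [h.1, h.2])

open scoped Pointwise

/-- The action of a rigid motion `g = (z, h) ∈ G₀` on a point `x ∈ F²`: `g x = z + h x`. -/
def G0.act {F : Type} [Field F] (g : G0 F) (x : Fin 2 → F) : Fin 2 → F :=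
  Multiplicative.toAdd g.left + (SO2.mat g.right).mulVec x

/-- The "squared distance" `‖x - y‖ = (x₁ - y₁)² + (x₂ - y₂)²` on `F²`. -/
def sqDist {F : Type} [Field F] (x y : Fin 2 → F) : F :=
  (x 0 - y 0) ^ 2 + (x 1 - y 1) ^ 2

open Finset in
open scoped Classical in
/-- The Parseval identity for exponential sums over a finite index set. -/
lemma AddChar.sum_norm_sq_sum_apply {V ι : Type*} [AddCommGroup V] [Fintype V]
    (s : Finset ι) (a : ι → V) :
    ∑ ψ : AddChar V ℂ, ‖∑ i ∈ s, ψ (a i)‖ ^ 2 =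
      (Fintype.card V : ℝ) * (#{p ∈ s ×ˢ s | a p.1 = a p.2} : ℝ) := by
  have hψ (ψ : AddChar V ℂ) :
      ((‖∑ i ∈ s, ψ (a i)‖ ^ 2 : ℝ) : ℂ) = ∑ p ∈ s ×ˢ s, ψ (a p.1 - a p.2) := by
    rw [Complex.ofReal_pow, ← Complex.mul_conj', map_sum, sum_mul_sum, sum_product]
    refine sum_congr rfl fun i _ ↦ sum_congr rfl fun j _ ↦ ?_
    rw [← AddChar.map_neg_eq_conj, ← AddChar.map_add_eq_mul, sub_eq_add_neg]
  rw [← Complex.ofReal_inj, Complex.ofReal_sum]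
  simp_rw [hψ]
  rw [sum_comm]
  simp_rw [AddChar.sum_apply_eq_ite, sub_eq_zero]
  rw [← sum_filter, sum_const, nsmul_eq_mul]
  push_cast
  ring

namespace SemidirectProduct

variable {V H : Type*} [AddCommGroup V] [Group H] {φ : H →* MulAut (Multiplicative V)}

/-- The pullback of an additive character of `V` along the action of `h : H`. -/
def pullbackChar (φ : H →* MulAut (Multiplicative V)) (h : H) (ψ : AddChar V ℂ) : AddChar V ℂ :=
  ψ.compAddMonoidHom (AddMonoidHom.toMultiplicative.symm (φ h).toMonoidHom)

lemma pullbackChar_apply (h : H) (ψ : AddChar V ℂ) (v : V) :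
    pullbackChar φ h ψ v = ψ (φ h (Multiplicative.ofAdd v)).toAdd := rfl

/-- If every nontrivial element of `H` acts without nontrivial fixed points, then `H` acts freely
on the nontrivial characters. -/
lemma pullbackChar_injective [Finite V]
    (hφ : ∀ h : H, h ≠ 1 → MonoidHom.FixedPointFree (φ h)) {ψ : AddChar V ℂ} (hψ : ψ ≠ 0) :
    Function.Injective fun h ↦ pullbackChar φ h ψ := by
  intro h k hhk
  by_contra hne
  refine hψ (DFunLike.ext _ _ fun v ↦ ?_)
  obtain ⟨w, hw⟩ := (hφ (h * k⁻¹) (by rwa [Ne, mul_inv_eq_one])).commutatorMap_surjective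
    (Multiplicative.ofAdd v)
  have key := DFunLike.congr_fun hhk (φ k⁻¹ w).toAdd
  simp only [pullbackChar_apply, ofAdd_toAdd, ← MulAut.mul_apply, ← map_mul, mul_inv_cancel,
    map_one, MulAut.one_apply] at key
  have hv : v = w.toAdd - (φ (h * k⁻¹) w).toAdd := by
    rw [← toAdd_ofAdd v, ← hw]
    rfl
  rw [hv, AddChar.map_sub_eq_div, key, AddChar.zero_apply]
  exact div_self (norm_ne_zero_iff.1 (by rw [AddChar.norm_apply]; exact one_ne_zero))

open scoped Classical in
/-- The Fourier transform, at the character `ψ`, of the fibre of `X` over `h`. -/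
noncomputable def fiberSum (X : Finset (Multiplicative V ⋊[φ] H)) (h : H) (ψ : AddChar V ℂ) : ℂ :=
  ∑ x ∈ X with x.right = h, ψ x.left.toAdd

open Finset

open scoped Classical in
lemma sum_norm_sq_fiberSum [Fintype V] (X : Finset (Multiplicative V ⋊[φ] H)) (h : H) :
    ∑ ψ, ‖fiberSum X h ψ‖ ^ 2 = (Fintype.card V : ℝ) * (#{x ∈ X | x.right = h} : ℝ) := by
  unfold fiberSum
  rw [AddChar.sum_norm_sq_sum_apply]
  rw [← diag_card {x ∈ X | x.right = h}]
  congr 3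
  ext ⟨x, y⟩
  simp only [mem_filter, mem_product, mem_diag]
  constructor
  · rintro ⟨⟨hx, hy⟩, hxy⟩
    exact ⟨hx, SemidirectProduct.ext (Multiplicative.toAdd.injective hxy) (hx.2.trans hy.2.symm)⟩
  · rintro ⟨hx, rfl⟩
    exact ⟨⟨hx, hx⟩, rfl⟩

open scoped Classical in
lemma sum_card_fiber [Fintype H] (X : Finset (Multiplicative V ⋊[φ] H)) :
    ∑ h, #{x ∈ X | x.right = h} = #X :=
  (card_eq_sum_card_fiberwise fun _ _ ↦ mem_coe.2 (mem_univ _)).symm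

lemma sum_sum_norm_sq_fiberSum [Fintype V] [Fintype H] (X : Finset (Multiplicative V ⋊[φ] H)) :
    ∑ h, ∑ ψ, ‖fiberSum X h ψ‖ ^ 2 = (Fintype.card V : ℝ) * (#X : ℝ) := by
  classical
  simp_rw [sum_norm_sq_fiberSum]
  rw [← mul_sum, ← Nat.cast_sum, sum_card_fiber]

open scoped Classical in
/-- The Fourier transform of the fibres of the convolution of the indicator of `X` with itself. -/
lemma sum_apply_mul_left [Fintype H] (X : Finset (Multiplicative V ⋊[φ] H)) (h : H)
    (ψ : AddChar V ℂ) :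
    ∑ p ∈ X ×ˢ X with p.1.right * p.2.right = h, ψ (p.1 * p.2).left.toAdd =
      ∑ k, fiberSum X k ψ * fiberSum X (k⁻¹ * h) (pullbackChar φ k ψ) := by
  rw [← sum_fiberwise _ (fun p ↦ p.1.right)]
  refine sum_congr rfl fun k _ ↦ ?_
  have hs : {p ∈ {p ∈ X ×ˢ X | p.1.right * p.2.right = h} | p.1.right = k} =
      {x ∈ X | x.right = k} ×ˢ {x ∈ X | x.right = k⁻¹ * h} := by
    ext ⟨x, y⟩
    simp only [mem_filter, mem_product, eq_inv_mul_iff_mul_eq]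
    constructor
    · rintro ⟨⟨⟨hx, hy⟩, hxy⟩, rfl⟩
      exact ⟨⟨hx, rfl⟩, hy, hxy⟩
    · rintro ⟨⟨hx, rfl⟩, hy, hxy⟩
      exact ⟨⟨⟨hx, hy⟩, hxy⟩, rfl⟩
  rw [hs, fiberSum, fiberSum, sum_mul_sum, sum_product]
  refine sum_congr rfl fun x hx ↦ sum_congr rfl fun y _ ↦ ?_
  rw [pullbackChar_apply, ofAdd_toAdd, mul_left, toAdd_mul, AddChar.map_add_eq_mul,
    (mem_filter.1 hx).2]

open scoped Classical in
lemma card_mul_mulEnergy_le [Fintype V] [Fintype H] (X : Finset (Multiplicative V ⋊[φ] H)) :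
    (Fintype.card V : ℝ) * (mulEnergy X X : ℝ) ≤
      ∑ ψ, ∑ h, ‖∑ k, fiberSum X k ψ * fiberSum X (k⁻¹ * h) (pullbackChar φ k ψ)‖ ^ 2 := by
  simp_rw [← sum_apply_mul_left]
  rw [sum_comm]
  simp_rw [AddChar.sum_norm_sq_sum_apply]
  rw [← mul_sum, ← Nat.cast_sum]
  gcongr
  rw [mulEnergy, card_eq_sum_card_fiberwise (t := univ)
    (f := fun p ↦ p.1.1.right * p.2.1.right) fun _ _ ↦ mem_coe.2 (mem_univ _)]
  refine sum_le_sum fun h _ ↦ card_le_card_of_injOn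
    (fun p ↦ ((p.1.1, p.2.1), (p.1.2, p.2.2))) ?_ ?_
  · rintro ⟨⟨x, x'⟩, y, y'⟩ hp
    simp only [coe_filter, mem_filter, mem_product, Set.mem_ofPred_eq] at hp ⊢
    obtain ⟨⟨⟨⟨hx, hx'⟩, hy, hy'⟩, heq⟩, hh⟩ := hp
    refine ⟨⟨⟨⟨hx, hy⟩, hh⟩, ⟨hx', hy'⟩, ?_⟩, by rw [heq]⟩
    rw [← hh, ← mul_right, ← mul_right, heq]
  · rintro ⟨⟨x, x'⟩, y, y'⟩ _ ⟨⟨z, z'⟩, w, w'⟩ _ heq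
    simp only [Prod.mk.injEq] at heq ⊢
    tauto

lemma sum_norm_sq_convolution_le_of_ne_zero [Fintype V] [Fintype H]
    (hφ : ∀ h : H, h ≠ 1 → MonoidHom.FixedPointFree (φ h))
    (X : Finset (Multiplicative V ⋊[φ] H)) {ψ : AddChar V ℂ} (hψ : ψ ≠ 0) :
    ∑ h, ‖∑ k, fiberSum X k ψ * fiberSum X (k⁻¹ * h) (pullbackChar φ k ψ)‖ ^ 2 ≤
      (∑ k, ‖fiberSum X k ψ‖ ^ 2) * ((Fintype.card V : ℝ) * (#X : ℝ)) := by
  have hcs (h : H) :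
      ‖∑ k, fiberSum X k ψ * fiberSum X (k⁻¹ * h) (pullbackChar φ k ψ)‖ ^ 2 ≤
        (∑ k, ‖fiberSum X k ψ‖ ^ 2) *
          ∑ k, ‖fiberSum X (k⁻¹ * h) (pullbackChar φ k ψ)‖ ^ 2 := by
    refine le_trans ?_ (sum_mul_sq_le_sq_mul_sq _ _ _)
    gcongr
    exact (norm_sum_le _ _).trans_eq (sum_congr rfl fun k _ ↦ norm_mul _ _)
  refine (sum_le_sum fun h _ ↦ hcs h).trans ?_
  rw [← mul_sum, ← sum_sum_norm_sq_fiberSum]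
  refine mul_le_mul_of_nonneg_left ?_ (sum_nonneg fun _ _ ↦ by positivity)
  rw [sum_comm]
  have hshift (k : H) : ∑ h, ‖fiberSum X (k⁻¹ * h) (pullbackChar φ k ψ)‖ ^ 2 =
      ∑ h, ‖fiberSum X h (pullbackChar φ k ψ)‖ ^ 2 :=
    Equiv.sum_comp (Equiv.mulLeft k⁻¹) fun h ↦ ‖fiberSum X h (pullbackChar φ k ψ)‖ ^ 2
  simp_rw [hshift]
  rw [sum_comm]
  refine sum_le_sum fun h _ ↦ ?_
  classical
  rw [← sum_image (f := fun χ ↦ ‖fiberSum X h χ‖ ^ 2) (g := fun k ↦ pullbackChar φ k ψ)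
    (pullbackChar_injective hφ hψ).injOn]
  exact sum_le_sum_of_subset_of_nonneg (subset_univ _) fun _ _ _ ↦ by positivity

open scoped Classical in
lemma sum_norm_sq_convolution_zero_le [Fintype H]
    (X : Finset (Multiplicative V ⋊[φ] H)) {M : ℝ} (hM : ∀ h, (#{x ∈ X | x.right = h} : ℝ) ≤ M) :
    ∑ h, ‖∑ k, fiberSum X k 0 * fiberSum X (k⁻¹ * h) (pullbackChar φ k 0)‖ ^ 2 ≤
      M * (#X : ℝ) ^ 3 := by
  have hpull (k : H) : pullbackChar φ k 0 = 0 := by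
    ext v
    rfl
  have hfib (k : H) : fiberSum X k 0 = ((#{x ∈ X | x.right = k} : ℝ) : ℂ) := by
    simp [fiberSum]
  have hsum : ∑ h : H, (#{x ∈ X | x.right = h} : ℝ) = #X := by
    rw [← Nat.cast_sum, sum_card_fiber]
  simp_rw [hpull, hfib, ← Complex.ofReal_mul, ← Complex.ofReal_sum, Complex.norm_real,
    Real.norm_eq_abs, sq_abs]
  set a : H → ℝ := fun h ↦ (#{x ∈ X | x.right = h} : ℝ)
  have ha0 (h : H) : 0 ≤ a h := Nat.cast_nonneg _
  have htotal : ∑ h, ∑ k, a k * a (k⁻¹ * h) = (#X : ℝ) ^ 2 := by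
    rw [sum_comm]
    simp_rw [← mul_sum]
    have hshift (k : H) : ∑ h, a (k⁻¹ * h) = #X :=
      (Equiv.sum_comp (Equiv.mulLeft k⁻¹) a).trans hsum
    simp_rw [hshift]
    rw [← sum_mul, hsum, sq]
  have hbound (h : H) : ∑ k, a k * a (k⁻¹ * h) ≤ M * #X := by
    rw [← hsum, mul_comm M, sum_mul]
    exact sum_le_sum fun k _ ↦ mul_le_mul_of_nonneg_left (hM _) (ha0 k)
  calc ∑ h, (∑ k, a k * a (k⁻¹ * h)) ^ 2
      ≤ ∑ h, M * #X * ∑ k, a k * a (k⁻¹ * h) := by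
        refine sum_le_sum fun h _ ↦ ?_
        rw [sq]
        exact mul_le_mul_of_nonneg_right (hbound h)
          (sum_nonneg fun k _ ↦ mul_nonneg (ha0 _) (ha0 _))
    _ = M * (#X : ℝ) ^ 3 := by
        rw [← mul_sum, htotal]
        ring

open scoped Classical in
/-- Energy bound in a Frobenius-type semidirect product `V ⋊ H`: if nontrivial elements of `H` act
without nontrivial fixed points and all fibres of `X` over `H` have at most `M` elements, then
`|V| E(X) ≤ M |X|³ + |V|² |X|²`. -/
theorem card_mul_mulEnergy_le_of_fixedPointFree [Fintype V] [Fintype H]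
    (hφ : ∀ h : H, h ≠ 1 → MonoidHom.FixedPointFree (φ h))
    (X : Finset (Multiplicative V ⋊[φ] H)) {M : ℝ} (hM : ∀ h, (#{x ∈ X | x.right = h} : ℝ) ≤ M) :
    (Fintype.card V : ℝ) * (mulEnergy X X : ℝ) ≤
      M * (#X : ℝ) ^ 3 + (Fintype.card V : ℝ) ^ 2 * (#X : ℝ) ^ 2 := by
  refine (card_mul_mulEnergy_le X).trans ?_
  rw [← add_sum_erase _ _ (mem_univ (0 : AddChar V ℂ))]
  refine add_le_add (sum_norm_sq_convolution_zero_le X hM) ?_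
  calc _ ≤ ∑ ψ ∈ univ.erase (0 : AddChar V ℂ),
        (∑ k, ‖fiberSum X k ψ‖ ^ 2) * ((Fintype.card V : ℝ) * (#X : ℝ)) :=
        sum_le_sum fun ψ hψ ↦ sum_norm_sq_convolution_le_of_ne_zero hφ X (ne_of_mem_erase hψ)
    _ ≤ ∑ ψ : AddChar V ℂ,
        (∑ k, ‖fiberSum X k ψ‖ ^ 2) * ((Fintype.card V : ℝ) * (#X : ℝ)) :=
        sum_le_sum_of_subset_of_nonneg (subset_univ _) fun _ _ _ ↦ by positivity
    _ = (Fintype.card V : ℝ) ^ 2 * (#X : ℝ) ^ 2 := by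
        rw [← sum_mul, sum_comm, sum_sum_norm_sq_fiberSum]
        ring

open scoped Classical Pointwise in
/-- Product growth in a Frobenius-type semidirect product `V ⋊ H`. -/
theorem half_mul_min_le_card_mul_self [Fintype V] [Fintype H]
    (hφ : ∀ h : H, h ≠ 1 → MonoidHom.FixedPointFree (φ h))
    (X : Finset (Multiplicative V ⋊[φ] H)) {M : ℝ} (hM₀ : 0 < M)
    (hM : ∀ h, (#{x ∈ X | x.right = h} : ℝ) ≤ M) :
    1 / 2 * min ((Fintype.card V : ℝ) * #X / M) ((#X : ℝ) ^ 2 / Fintype.card V) ≤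
      (#(X * X) : ℝ) := by
  have hV : (0 : ℝ) < Fintype.card V := by exact_mod_cast Fintype.card_pos
  rcases X.eq_empty_or_nonempty with rfl | hX
  · simp
  have hX₀ : (0 : ℝ) < #X := by exact_mod_cast hX.card_pos
  have henergy := card_mul_mulEnergy_le_of_fixedPointFree hφ X hM
  have hcs : (#X : ℝ) ^ 2 * (#X : ℝ) ^ 2 ≤ #(X * X) * (mulEnergy X X : ℝ) := by
    exact_mod_cast le_card_mul_mul_mulEnergy X X
  set v : ℝ := (Fintype.card V : ℝ)
  set n : ℝ := (#X : ℝ)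
  set P : ℝ := (#(X * X) : ℝ)
  set m := min (v * n / M) (n ^ 2 / v)
  have hP : 0 ≤ P := Nat.cast_nonneg _
  have h₁ : m * M ≤ v * n := (le_div_iff₀ hM₀).1 (min_le_left _ _)
  have h₂ : m * v ≤ n ^ 2 := (le_div_iff₀ hV).1 (min_le_right _ _)
  have hmain : v * n ^ 2 ≤ P * (M * n + v ^ 2) := by
    refine le_of_mul_le_mul_right ?_ (pow_pos hX₀ 2)
    calc v * n ^ 2 * n ^ 2 = v * (n ^ 2 * n ^ 2) := by ring
      _ ≤ v * (P * (mulEnergy X X : ℝ)) := by gcongr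
      _ = P * (v * (mulEnergy X X : ℝ)) := by ring
      _ ≤ P * (M * n ^ 3 + v ^ 2 * n ^ 2) := by gcongr
      _ = P * (M * n + v ^ 2) * n ^ 2 := by ring
  have hm : m * (M * n + v ^ 2) ≤ 2 * (v * n ^ 2) := by
    nlinarith [mul_le_mul_of_nonneg_right h₁ hX₀.le, mul_le_mul_of_nonneg_right h₂ hV.le]
  have hpos : 0 < M * n + v ^ 2 := by positivity
  refine le_of_mul_le_mul_right ?_ hpos
  linarith

open scoped Pointwise in
/-- `half_mul_min_le_card_mul_self` for sets. -/
theorem half_mul_min_le_natCard_mul_self [Finite V] [Finite H]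
    (hφ : ∀ h : H, h ≠ 1 → MonoidHom.FixedPointFree (φ h))
    (X : Set (Multiplicative V ⋊[φ] H)) {M : ℝ} (hM₀ : 0 < M)
    (hM : ∀ h, ({x ∈ X | x.right = h}.ncard : ℝ) ≤ M) :
    1 / 2 * min ((Nat.card V : ℝ) * Nat.card X / M) ((Nat.card X : ℝ) ^ 2 / Nat.card V) ≤
      (Nat.card ↥(X * X) : ℝ) := by
  classical
  have := Fintype.ofFinite V
  have := Fintype.ofFinite H
  have := Fintype.ofFinite (Multiplicative V ⋊[φ] H)
  have hM' (h : H) : (#{x ∈ X.toFinset | x.right = h} : ℝ) ≤ M := by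
    refine le_of_eq_of_le ?_ (hM h)
    rw [← Set.ncard_coe_finset]
    simp
  rw [Nat.card_eq_card_toFinset X, Nat.card_eq_card_toFinset (X * X), Set.toFinset_mul,
    Nat.card_eq_fintype_card]
  convert half_mul_min_le_card_mul_self hφ X.toFinset hM₀ fun h ↦ ?_
  convert hM' h

end SemidirectProduct

/-- Over a field of characteristic other than two, a nontrivial rotation fixes only the origin. -/
lemma rotHom_fixedPointFree {F : Type} [Field F] (h2 : (2 : F) ≠ 0) (h : SO2 F) (hh : h ≠ 1) :
    MonoidHom.FixedPointFree (rotHom F h) := by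
  intro v hv
  obtain ⟨a, b, hab, hmat⟩ := h.2
  have hfix : (SO2.mat h).mulVec v.toAdd = v.toAdd := hv
  rw [SO2.mat, hmat] at hfix
  have h₀ : a * v.toAdd 0 - b * v.toAdd 1 = v.toAdd 0 := by
    simpa [Matrix.mulVec, dotProduct, Fin.sum_univ_two, sub_eq_add_neg] using congrFun hfix 0
  have h₁ : b * v.toAdd 0 + a * v.toAdd 1 = v.toAdd 1 := by
    simpa [Matrix.mulVec, dotProduct, Fin.sum_univ_two] using congrFun hfix 1
  have ha : 1 - a ≠ 0 := by
    intro ha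
    obtain rfl : a = 1 := (sub_eq_zero.1 ha).symm
    have hb : b = 0 := pow_eq_zero_iff (two_ne_zero) |>.1 (by linear_combination hab)
    subst hb
    refine hh (Subtype.ext (Units.ext ?_))
    rw [hmat]
    simp [Matrix.one_fin_two]
  have hdet : 2 * (1 - a) ≠ 0 := mul_ne_zero h2 ha
  have e₀ : v.toAdd 0 = 0 := by
    refine (mul_eq_zero.1 (?_ : 2 * (1 - a) * v.toAdd 0 = 0)).resolve_left hdet
    linear_combination (a - 1) * h₀ + b * h₁ - v.toAdd 0 * hab
  have e₁ : v.toAdd 1 = 0 := by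
    refine (mul_eq_zero.1 (?_ : 2 * (1 - a) * v.toAdd 1 = 0)).resolve_left hdet
    linear_combination (a - 1) * h₁ - b * h₀ - v.toAdd 1 * hab
  refine Multiplicative.toAdd.injective (funext fun i ↦ ?_)
  fin_cases i
  · exact e₀
  · exact e₁

/-- A rigid motion is determined by its rotation part and the preimage of one point. -/
lemma G0.ext_of_act_inv {F : Type} [Field F] {g k : G0 F} (hr : g.right = k.right)
    {u : Fin 2 → F} (hu : G0.act g⁻¹ u = G0.act k⁻¹ u) : g = k := by
  have hinv : g⁻¹.right = k⁻¹.right := by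
    rw [SemidirectProduct.inv_right, SemidirectProduct.inv_right, hr]
  rw [G0.act, G0.act, hinv, add_left_inj] at hu
  exact inv_injective (SemidirectProduct.ext (Multiplicative.toAdd.injective hu) hinv)

/-- **Theorem 1.14 (quantitative form).** There is an absolute constant `c > 0` such
that: for `E ⊆ 𝔽_q²`, `t ≠ 0`, and a line segment `(u₀, v₀) ∈ E × E` of length `t`,
the set `X_t` of rigid motions mapping some segment of length `t` in `E × E` to
`(u₀, v₀)`, i.e. `X_t = {g : g⁻¹u₀ ∈ E, g⁻¹v₀ ∈ E}`, satisfies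
`|X_t X_t| ≥ c·min{ q²|X_t|/|E| , |X_t|²/q² }`. -/
theorem product_growth_distance_G0 :
    ∃ c : ℝ, 0 < c ∧
      ∀ (F : Type) [Field F] [Fintype F] (q : ℕ), q = Fintype.card F → Odd q →
        ∀ (E : Set (Fin 2 → F)) (t : F), t ≠ 0 →
        ∀ u₀ v₀ : Fin 2 → F, u₀ ∈ E → v₀ ∈ E → sqDist u₀ v₀ = t →
        c * min ((q : ℝ) ^ 2 *
              (Nat.card {g : G0 F | G0.act g⁻¹ u₀ ∈ E ∧ G0.act g⁻¹ v₀ ∈ E} : ℝ) /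
              (Nat.card E : ℝ))
            ((Nat.card {g : G0 F | G0.act g⁻¹ u₀ ∈ E ∧ G0.act g⁻¹ v₀ ∈ E} : ℝ) ^ 2 /
              (q : ℝ) ^ 2) ≤
          (Nat.card ↥({g : G0 F | G0.act g⁻¹ u₀ ∈ E ∧ G0.act g⁻¹ v₀ ∈ E} *
            {g : G0 F | G0.act g⁻¹ u₀ ∈ E ∧ G0.act g⁻¹ v₀ ∈ E}) : ℝ) := by
  refine ⟨1 / 2, by norm_num, ?_⟩
  intro F _ _ q hq hodd E t _ u₀ v₀ hu₀ _ _
  have h2 : (2 : F) ≠ 0 := by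
    refine Ring.two_ne_zero fun hchar ↦ ?_
    have := FiniteField.even_card_of_char_two hchar
    rw [← hq] at this
    rw [Nat.odd_iff] at hodd
    omega
  have hcard : (Nat.card (Fin 2 → F) : ℝ) = (q : ℝ) ^ 2 := by
    simp [hq]
  have hE : (0 : ℝ) < Nat.card E := by
    have : Nonempty E := ⟨⟨u₀, hu₀⟩⟩
    exact_mod_cast Nat.card_pos
  rw [← hcard]
  refine SemidirectProduct.half_mul_min_le_natCard_mul_self (rotHom_fixedPointFree h2) _ hE
    fun h ↦ Nat.cast_le.2 ?_
  rw [Nat.card_coe_set_eq]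
  exact Set.ncard_le_ncard_of_injOn (fun g ↦ G0.act g⁻¹ u₀) (fun g hg ↦ hg.1.1)
    (fun g hg k hk hgk ↦ G0.ext_of_act_inv (hg.2.trans hk.2.symm) hgk) E.toFinite
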